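/- Fix an odd integer γ ≥ 3 and set t = (γ+1)²/2, r = (−t, γ+1). Let the red points be (0,2i) for i ∈ {1,…,γ} together with r, and the blue points be (1,2i+1) for i ∈ {1,…,γ−1} together with b = (2t, γ+1). Then every red point x satisfies ‖x − r‖ < √(t²+2t), while every blue point y satisfies ‖y − r‖ ≥ t+1 > √(t²+2t); i.e., the open ball B(r, √(t²+2t)) contains all red points and no blue point. -/

import Mathlib

noncomputable section
open Classical

/-- The Euclidean plane. -/
abbrev Pt := EuclideanSpace ℝ (Fin 2)

/-- The point `(a, b)` of the Euclidean plane. -/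
def pt (a b : ℝ) : Pt := (WithLp.equiv 2 (Fin 2 → ℝ)).symm ![a, b]

/-- `t = (γ+1)²/2`. -/
def tval (γ : ℕ) : ℝ := ((γ : ℝ) + 1) ^ 2 / 2

/-- The red points: `(0, 2i)` for `i ∈ {1,…,γ}` together with `r = (-t, γ+1)`. -/
def RedPts (γ : ℕ) : Finset Pt :=
  ((Finset.Icc 1 γ).image fun i => pt 0 (2 * (i : ℝ))) ∪
    {pt (-(tval γ)) ((γ : ℝ) + 1)}

/-- The blue points: `(1, 2i+1)` for `i ∈ {1,…,γ-1}` together with `b = (2t, γ+1)`. -/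
def BluePts (γ : ℕ) : Finset Pt :=
  ((Finset.Icc 1 (γ - 1)).image fun i => pt 1 (2 * (i : ℝ) + 1)) ∪
    {pt (2 * tval γ) ((γ : ℝ) + 1)}

/-- The Euclidean distance between two points of the plane in coordinates. -/
theorem dist_pt (a b c d : ℝ) :
    dist (pt a b) (pt c d) = Real.sqrt ((a - c) ^ 2 + (b - d) ^ 2) := by
  simp [pt, EuclideanSpace.dist_eq, Fin.sum_univ_two, Real.dist_eq, sq_abs]

/-- For odd `γ ≥ 3` with `t = (γ+1)²/2` and `r = (-t, γ+1)`: every red point lies at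
distance `< √(t²+2t)` from `r`, while every blue point lies at distance `≥ t+1`
from `r`, and `t+1 > √(t²+2t)`; i.e. the open ball `B(r, √(t²+2t))` contains all red
points and no blue point. -/
theorem stmt12 (γ : ℕ) (hodd : Odd γ) (hγ : 3 ≤ γ) :
    (∀ x ∈ RedPts γ,
      dist x (pt (-(tval γ)) ((γ : ℝ) + 1)) <
        Real.sqrt ((tval γ) ^ 2 + 2 * tval γ)) ∧
    (∀ y ∈ BluePts γ,
      tval γ + 1 ≤ dist y (pt (-(tval γ)) ((γ : ℝ) + 1))) ∧
    Real.sqrt ((tval γ) ^ 2 + 2 * tval γ) < tval γ + 1 ∧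
    (∀ x ∈ RedPts γ,
      x ∈ Metric.ball (pt (-(tval γ)) ((γ : ℝ) + 1))
        (Real.sqrt ((tval γ) ^ 2 + 2 * tval γ))) ∧
    (∀ y ∈ BluePts γ,
      y ∉ Metric.ball (pt (-(tval γ)) ((γ : ℝ) + 1))
        (Real.sqrt ((tval γ) ^ 2 + 2 * tval γ))) := by
  have hγ' : (3 : ℝ) ≤ γ := by exact_mod_cast hγ
  have ht : 2 * tval γ = ((γ : ℝ) + 1) ^ 2 := by unfold tval; ring
  have htpos : 0 < tval γ := by unfold tval; positivity
  have hred : ∀ x ∈ RedPts γ, dist x (pt (-(tval γ)) ((γ : ℝ) + 1)) <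
      Real.sqrt ((tval γ) ^ 2 + 2 * tval γ) := by
    intro x hx
    simp only [RedPts, Finset.mem_union, Finset.mem_image, Finset.bind_def,
      Finset.pure_def, Finset.mem_sup, Finset.mem_Icc, Finset.mem_singleton] at hx
    rcases hx with ⟨_, ⟨i, ⟨hi₁, hi₂⟩, rfl⟩, rfl⟩ | rfl
    · have h₁ : (1 : ℝ) ≤ i := by exact_mod_cast hi₁
      have h₂ : (i : ℝ) ≤ γ := by exact_mod_cast hi₂
      rw [dist_pt]
      apply Real.sqrt_lt_sqrt (by positivity)
      nlinarith [mul_nonneg (sub_nonneg.2 h₁) (sub_nonneg.2 h₂)]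
    · rw [dist_self]
      positivity
  have hblue : ∀ y ∈ BluePts γ,
      tval γ + 1 ≤ dist y (pt (-(tval γ)) ((γ : ℝ) + 1)) := by
    intro y hy
    simp only [BluePts, Finset.mem_union, Finset.mem_image, Finset.mem_singleton] at hy
    rcases hy with ⟨i, -, rfl⟩ | rfl
    · rw [dist_pt]
      apply Real.le_sqrt_of_sq_le
      nlinarith [sq_nonneg (2 * (i : ℝ) + 1 - (γ + 1))]
    · rw [dist_pt]
      apply Real.le_sqrt_of_sq_le
      have h : tval γ + 1 ≤ 3 * tval γ := by nlinarith
      nlinarith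
  have hlt : Real.sqrt ((tval γ) ^ 2 + 2 * tval γ) < tval γ + 1 := by
    rw [Real.sqrt_lt' (by linarith)]
    linarith
  exact ⟨hred, hblue, hlt, fun x hx => Metric.mem_ball.2 (hred x hx),
    fun y hy h => absurd (Metric.mem_ball.1 h) (not_lt.2 (hlt.le.trans (hblue y hy)))⟩
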